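/- arXiv:2201.06649 — 2 statements merged into one kernel-verified Lean document; each statement's English description precedes it below -/
import Mathlib

section
/- Let r_o ≥ ρ_o > 0. Then the Gaussian Schell-model kernel K(x, y) = exp( −|x+y|²/(4 r_o²) − |x−y|²/(4 ρ_o²) ) is a positive semidefinite kernel on ℝ²: for every n ∈ ℕ, every family of points x₁, …, xₙ ∈ ℝ² and every family of coefficients c₁, …, cₙ ∈ ℂ, the sum Σ_{i,j=1}^n conj(c_i) c_j K(x_i, x_j) is a nonnegative real number. -/
open scoped ComplexConjugate

/-- `ℝ²` as a Euclidean space. -/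
abbrev E2 := EuclideanSpace ℝ (Fin 2)

open MeasureTheory in
/-- The easy half of Bochner's theorem: a characteristic function is positive semidefinite, its
quadratic form being the integral of a squared norm. -/
theorem sum_conj_mul_charFun_sub {E ι : Type*} [NormedAddCommGroup E] [InnerProductSpace ℝ E]
    [MeasurableSpace E] [OpensMeasurableSpace E] [SecondCountableTopology E] [Fintype ι]
    (μ : Measure E) [IsFiniteMeasure μ] (x : ι → E) (c : ι → ℂ) :
    ∑ i, ∑ j, conj (c i) * c j * charFun μ (x i - x j) =
      ((∫ w, ‖∑ i, conj (c i) * Complex.exp (inner ℝ w (x i) * Complex.I)‖ ^ 2 ∂μ : ℝ) : ℂ) := by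
  have h_int (t : E) : Integrable (fun w ↦ Complex.exp (inner ℝ w t * Complex.I)) μ := by
    refine Integrable.of_bound (C := 1) (by fun_prop) (ae_of_all _ fun w ↦ ?_)
    rw [Complex.norm_exp_ofReal_mul_I]
  simp_rw [charFun_apply, ← integral_const_mul]
  rw [← integral_complex_ofReal]
  calc
    _ = ∫ w, ∑ i, ∑ j, conj (c i) * c j *
          Complex.exp (inner ℝ w (x i - x j) * Complex.I) ∂μ := by
      rw [integral_finsetSum _ fun i _ ↦ integrable_finsetSum _ fun j _ ↦ (h_int _).const_mul _]
      exact Finset.sum_congr rfl fun i _ ↦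
        (integral_finsetSum _ fun j _ ↦ (h_int _).const_mul _).symm
    _ = _ := by
      congr 1 with w
      rw [Complex.ofReal_pow, ← Complex.mul_conj', map_sum, Finset.sum_mul_sum]
      refine Finset.sum_congr rfl fun i _ ↦ Finset.sum_congr rfl fun j _ ↦ ?_
      rw [inner_sub_right, Complex.ofReal_sub, sub_mul, sub_eq_add_neg, Complex.exp_add]
      simp only [map_mul, Complex.conj_conj, ← Complex.exp_conj, Complex.conj_ofReal,
        Complex.conj_I, mul_neg]
      ring

/-- For `r_o ≥ ρ_o > 0`, the Gauss-Schell covariance kernel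
`K(x,y) = exp(−|x+y|²/(4r_o²) − |x−y|²/(4ρ_o²))` is a positive semidefinite kernel on `ℝ²`:
for any points `x₁,…,xₙ` and complex coefficients `c₁,…,cₙ`, the quadratic form
`Σ_{i,j} conj(c_i) c_j K(x_i, x_j)` is a nonnegative real number. -/
theorem gauss_schell_kernel_posdef
    (ro ρo : ℝ) (hρo : 0 < ρo) (hle : ρo ≤ ro)
    (n : ℕ) (x : Fin n → E2) (c : Fin n → ℂ) :
    ∃ s : ℝ, 0 ≤ s ∧
      (∑ i : Fin n, ∑ j : Fin n, conj (c i) * c j *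
        ((Real.exp (-(‖x i + x j‖ ^ 2 / (4 * ro ^ 2))
            - ‖x i - x j‖ ^ 2 / (4 * ρo ^ 2)) : ℝ) : ℂ)) = (s : ℂ) := by
  have h_pos : 0 ≤ 1 / (4 * ρo ^ 2) - 1 / (4 * ro ^ 2) :=
    sub_nonneg.2 (one_div_le_one_div_of_le (by positivity) (by gcongr))
  set a : ℝ := 1 / (4 * ro ^ 2) with ha
  set b : ℝ := 1 / (4 * ρo ^ 2) with hb
  set σ : ℝ := √(2 * (b - a))
  have hσ_sq : σ ^ 2 = 2 * (b - a) := Real.sq_sqrt (by positivity)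
  refine ⟨_, MeasureTheory.integral_nonneg fun w ↦ sq_nonneg _,
    Eq.trans ?_ (sum_conj_mul_charFun_sub (ProbabilityTheory.stdGaussian E2) (fun i ↦ σ • x i)
      fun i ↦ c i * (Real.exp (-(2 * a * ‖x i‖ ^ 2)) : ℝ))⟩
  refine Finset.sum_congr rfl fun i _ ↦ Finset.sum_congr rfl fun j _ ↦ ?_
  have h_par : ‖x i + x j‖ ^ 2 = 2 * ‖x i‖ ^ 2 + 2 * ‖x j‖ ^ 2 - ‖x i - x j‖ ^ 2 := by
    linear_combination parallelogram_law_with_norm ℝ (x i) (x j)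
  have h_exp : -(‖x i + x j‖ ^ 2 / (4 * ro ^ 2)) - ‖x i - x j‖ ^ 2 / (4 * ρo ^ 2) =
      -(2 * a * ‖x i‖ ^ 2) + -(2 * a * ‖x j‖ ^ 2) + -‖σ • x i - σ • x j‖ ^ 2 / 2 := by
    rw [← smul_sub, norm_smul, mul_pow, Real.norm_eq_abs, sq_abs, hσ_sq, div_eq_mul_one_div,
      div_eq_mul_one_div (‖x i - x j‖ ^ 2), ← ha, ← hb, h_par]
    ring
  rw [h_exp, ProbabilityTheory.charFun_stdGaussian, Real.exp_add, Real.exp_add, map_mul,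
    Complex.conj_ofReal]
  push_cast
  ring
end

section
/- Let k_o > 0, r_o > 0, ρ_o > 0. (a) If γ̄₂ = 0 (homogeneous medium) then θ(z;ρ_o) · ρ²(z;ρ_o) → ∞ as z → ∞, i.e., 1/√θ(z;ρ_o) becomes negligible compared to ρ(z;ρ_o) ≤ R(z;ρ_o). (b) If γ̄₂ > 0 (random medium) then θ(z;ρ_o) · ρ²(z;ρ_o) → 0 and θ(z;ρ_o) · R²(z;ρ_o) → ∞ as z → ∞, i.e., ρ(z;ρ_o) ≪ 1/√θ(z;ρ_o) ≪ R(z;ρ_o) for large z. -/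
open Filter

/-- Squared beam radius `R²(z;ρ_o)` of the transmitted beam. -/
noncomputable def R2 (ko ro ρo γ z : ℝ) : ℝ :=
  ro ^ 2 * (1 + γ * z ^ 3 / (3 * ro ^ 2) + z ^ 2 / (ko ^ 2 * ro ^ 2 * ρo ^ 2))

/-- Squared correlation radius `ρ²(z;ρ_o)` of the transmitted beam. -/
noncomputable def rho2 (ko ro ρo γ z : ℝ) : ℝ :=
  ρo ^ 2 * (1 + γ * z ^ 3 / (3 * ro ^ 2) + z ^ 2 / (ko ^ 2 * ρo ^ 2 * ro ^ 2)) /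
    (1 + ko ^ 2 * ρo ^ 2 * γ * z *
      (1 + γ * z ^ 3 / (12 * ro ^ 2) + z ^ 2 / (3 * ko ^ 2 * ρo ^ 2 * ro ^ 2)))

/-- Coherent phase-modulation parameter `θ(z;ρ_o)` of the transmitted beam. -/
noncomputable def theta (ko ro ρo γ z : ℝ) : ℝ :=
  (z / (ko * ρo ^ 2) + ko * γ * z ^ 2 / 2) /
    (ro ^ 2 + γ * z ^ 3 / 3 + z ^ 2 / (ko ^ 2 * ρo ^ 2))

theorem theta_mul_R2 {ko ro ρo γ z : ℝ} (hko : 0 < ko) (hro : 0 < ro) (hρo : 0 < ρo)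
    (hγ : 0 ≤ γ) (hz : 0 ≤ z) :
    theta ko ro ρo γ z * R2 ko ro ρo γ z = z / (ko * ρo ^ 2) + ko * γ * z ^ 2 / 2 := by
  have hR : R2 ko ro ρo γ z = ro ^ 2 + γ * z ^ 3 / 3 + z ^ 2 / (ko ^ 2 * ρo ^ 2) := by
    unfold R2
    field_simp
  have hD : 0 < ro ^ 2 + γ * z ^ 3 / 3 + z ^ 2 / (ko ^ 2 * ρo ^ 2) := by positivity
  rw [hR, theta, div_mul_cancel₀ _ hD.ne']

theorem rho2_eq_R2_mul {ko ro ρo γ z : ℝ} (hro : ro ≠ 0) :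
    rho2 ko ro ρo γ z = R2 ko ro ρo γ z * (ρo ^ 2 / ro ^ 2 /
      (1 + ko ^ 2 * ρo ^ 2 * γ * z *
        (1 + γ * z ^ 3 / (12 * ro ^ 2) + z ^ 2 / (3 * ko ^ 2 * ρo ^ 2 * ro ^ 2)))) := by
  rw [rho2, R2, mul_right_comm (ko ^ 2) (ρo ^ 2) (ro ^ 2)]
  field_simp

theorem theta_mul_rho2 {ko ro ρo γ z : ℝ} (hko : 0 < ko) (hro : 0 < ro) (hρo : 0 < ρo)
    (hγ : 0 ≤ γ) (hz : 0 ≤ z) :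
    theta ko ro ρo γ z * rho2 ko ro ρo γ z =
      (z / (ko * ρo ^ 2) + ko * γ * z ^ 2 / 2) * (ρo ^ 2 / ro ^ 2 /
        (1 + ko ^ 2 * ρo ^ 2 * γ * z *
          (1 + γ * z ^ 3 / (12 * ro ^ 2) + z ^ 2 / (3 * ko ^ 2 * ρo ^ 2 * ro ^ 2)))) := by
  rw [rho2_eq_R2_mul hro.ne', ← mul_assoc, theta_mul_R2 hko hro hρo hγ hz]

/-- (a) In a homogeneous medium (`γ̄₂ = 0`), `θ(z;ρ_o)·ρ²(z;ρ_o) → ∞` as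
`z → ∞`, i.e. `1/√θ` is negligible compared to `ρ(z;ρ_o) ≤ R(z;ρ_o)`.
(b) In a random medium (`γ̄₂ > 0`), `θ(z;ρ_o)·ρ²(z;ρ_o) → 0` and
`θ(z;ρ_o)·R²(z;ρ_o) → ∞` as `z → ∞`, i.e. `ρ(z;ρ_o) ≪ 1/√θ(z;ρ_o) ≪ R(z;ρ_o)`. -/
theorem phase_modulation_vs_coherence_scales
    (ko ro ρo : ℝ) (hko : 0 < ko) (hro : 0 < ro) (hρo : 0 < ρo) :
    Tendsto (fun z : ℝ => theta ko ro ρo 0 z * rho2 ko ro ρo 0 z) atTop atTop ∧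
    ∀ γ : ℝ, 0 < γ →
      Tendsto (fun z : ℝ => theta ko ro ρo γ z * rho2 ko ro ρo γ z) atTop (nhds 0) ∧
      Tendsto (fun z : ℝ => theta ko ro ρo γ z * R2 ko ro ρo γ z) atTop atTop := by
  refine ⟨?_, fun γ hγ => ⟨?_, ?_⟩⟩
  · have h : Tendsto (fun z : ℝ => z / (ko * ro ^ 2)) atTop atTop :=
      tendsto_id.atTop_div_const (by positivity)
    refine h.congr' ?_
    filter_upwards [eventually_ge_atTop 0] with z hz
    rw [theta_mul_rho2 hko hro hρo le_rfl hz]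
    simp only [mul_zero, zero_mul, zero_div, add_zero, div_one]
    field_simp
  · have hlim : Tendsto (fun z : ℝ => (1 / (ko * ρo ^ 2) + ko * γ / 2) * (ρo ^ 2 / ro ^ 2 /
        (ko ^ 2 * ρo ^ 2 * γ ^ 2 / (12 * ro ^ 2))) * (z ^ 2)⁻¹) atTop (nhds 0) := by
      simpa only [mul_zero, Pi.inv_apply] using
        (tendsto_pow_atTop (α := ℝ) two_ne_zero).inv_tendsto_atTop.const_mul
        ((1 / (ko * ρo ^ 2) + ko * γ / 2) * (ρo ^ 2 / ro ^ 2 /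
          (ko ^ 2 * ρo ^ 2 * γ ^ 2 / (12 * ro ^ 2))))
    refine squeeze_zero' ?_ ?_ hlim
    · filter_upwards [eventually_ge_atTop 0] with z hz
      rw [theta_mul_rho2 hko hro hρo hγ.le hz]
      positivity
    · filter_upwards [eventually_ge_atTop 1] with z hz
      have hz0 : 0 < z := by linarith
      rw [theta_mul_rho2 hko hro hρo hγ.le hz0.le]
      have hnum : z / (ko * ρo ^ 2) + ko * γ * z ^ 2 / 2 ≤
          (1 / (ko * ρo ^ 2) + ko * γ / 2) * z ^ 2 := by
        have : z / (ko * ρo ^ 2) ≤ z ^ 2 / (ko * ρo ^ 2) := by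
          gcongr
          nlinarith
        calc _ ≤ z ^ 2 / (ko * ρo ^ 2) + ko * γ * z ^ 2 / 2 := by gcongr
          _ = _ := by ring
      have hden : ko ^ 2 * ρo ^ 2 * γ ^ 2 / (12 * ro ^ 2) * z ^ 4 ≤
          1 + ko ^ 2 * ρo ^ 2 * γ * z *
            (1 + γ * z ^ 3 / (12 * ro ^ 2) + z ^ 2 / (3 * ko ^ 2 * ρo ^ 2 * ro ^ 2)) := by
        have : 0 ≤ 1 + ko ^ 2 * ρo ^ 2 * γ * z *
            (1 + z ^ 2 / (3 * ko ^ 2 * ρo ^ 2 * ro ^ 2)) := by positivity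
        calc _ ≤ ko ^ 2 * ρo ^ 2 * γ ^ 2 / (12 * ro ^ 2) * z ^ 4 + _ :=
              le_add_of_nonneg_right this
          _ = _ := by ring
      calc _ ≤ (1 / (ko * ρo ^ 2) + ko * γ / 2) * z ^ 2 * (ρo ^ 2 / ro ^ 2 /
            (ko ^ 2 * ρo ^ 2 * γ ^ 2 / (12 * ro ^ 2) * z ^ 4)) := by gcongr
        _ = _ := by field_simp
  · have h : Tendsto (fun z : ℝ => z / (ko * ρo ^ 2)) atTop atTop :=
      tendsto_id.atTop_div_const (by positivity)
    refine tendsto_atTop_mono' _ ?_ h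
    filter_upwards [eventually_ge_atTop 0] with z hz
    rw [theta_mul_R2 hko hro hρo hγ.le hz]
    exact le_add_of_nonneg_right (by positivity)
end
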